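/- Every subspace of ℂ^m ⊗ ℂ^n of dimension strictly greater than (m−1)(n−1) contains a nonzero product vector v ⊗ w. -/

import Mathlib

open Matrix Complex Finset

namespace SegreAux

variable (m n : ℕ)

/-- The Segre homomorphism `X (i, j) ↦ a i * b j`. -/
noncomputable def seg : MvPolynomial (Fin m × Fin n) ℂ →ₐ[ℂ] MvPolynomial (Fin m ⊕ Fin n) ℂ :=
  MvPolynomial.aeval fun p => MvPolynomial.X (Sum.inl p.1) * MvPolynomial.X (Sum.inr p.2)

/-- The coordinate ring of the Segre cone. -/
noncomputable abbrev R := (seg m n).range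

/-- The generators. -/
noncomputable def gen (p : Fin m × Fin n) : R m n := (seg m n).rangeRestrict (MvPolynomial.X p)

open Classical in
/-- Killing the variables in `T`. -/
noncomputable def kill {σ : Type*} (T : Set σ) : MvPolynomial σ ℂ →ₐ[ℂ] MvPolynomial σ ℂ :=
  MvPolynomial.aeval fun s => if s ∈ T then 0 else MvPolynomial.X s

/-- The prime of the Segre ring given by killing `T`. -/
noncomputable def pr (T : Set (Fin m ⊕ Fin n)) : Ideal (R m n) :=
  RingHom.ker ((kill T).comp (R m n).val)

/-- The irrelevant ideal. -/
noncomputable def irr : Ideal (R m n) :=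
  RingHom.ker ((MvPolynomial.aeval (fun _ => (0 : ℂ)) :
    MvPolynomial (Fin m ⊕ Fin n) ℂ →ₐ[ℂ] ℂ).comp (R m n).val)

instance (T : Set (Fin m ⊕ Fin n)) : (pr m n T).IsPrime := RingHom.ker_isPrime _
instance : (irr m n).IsPrime := RingHom.ker_isPrime _

theorem gen_val (p : Fin m × Fin n) : ((gen m n p : R m n) : MvPolynomial (Fin m ⊕ Fin n) ℂ) =
    MvPolynomial.X (Sum.inl p.1) * MvPolynomial.X (Sum.inr p.2) := by
  change seg m n (MvPolynomial.X p) = _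
  rw [seg, MvPolynomial.aeval_X]

theorem kill_kill {σ : Type*} {T U : Set σ} (h : T ⊆ U) : (kill U).comp (kill T) = kill U := by
  ext s
  by_cases hs : s ∈ T
  · simp [kill, hs, h hs]
  · simp [kill, hs]

theorem gen_mem_pr (T : Set (Fin m ⊕ Fin n)) (p : Fin m × Fin n) :
    gen m n p ∈ pr m n T ↔ Sum.inl p.1 ∈ T ∨ Sum.inr p.2 ∈ T := by
  rw [pr, RingHom.mem_ker]
  simp only [AlgHom.comp_apply, Subalgebra.coe_val, gen_val, map_mul, mul_eq_zero]
  simp [kill, MvPolynomial.X_ne_zero]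

theorem pr_lt {T U : Set (Fin m ⊕ Fin n)} (h : T ⊆ U) (p : Fin m × Fin n)
    (h1 : gen m n p ∉ pr m n T) (h2 : gen m n p ∈ pr m n U) : pr m n T < pr m n U := by
  refine lt_of_le_of_ne (fun x hx => ?_) (fun e => h1 (e ▸ h2))
  rw [pr, RingHom.mem_ker] at hx ⊢
  rw [← kill_kill h]
  simp only [AlgHom.comp_apply] at hx ⊢
  rw [hx, map_zero]

theorem pr_lt_irr {T : Set (Fin m ⊕ Fin n)} (p : Fin m × Fin n)
    (h1 : gen m n p ∉ pr m n T) : pr m n T < irr m n := by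
  have h2 : gen m n p ∈ irr m n := by
    rw [irr, RingHom.mem_ker]
    simp [gen_val]
  refine lt_of_le_of_ne (fun x hx => ?_) (fun e => h1 (e ▸ h2))
  rw [pr, RingHom.mem_ker] at hx
  rw [irr, RingHom.mem_ker]
  have : (MvPolynomial.aeval (fun _ => (0 : ℂ)) : MvPolynomial (Fin m ⊕ Fin n) ℂ →ₐ[ℂ] ℂ) =
      (MvPolynomial.aeval (fun _ => (0 : ℂ)) : MvPolynomial (Fin m ⊕ Fin n) ℂ →ₐ[ℂ] ℂ).comp
        (kill T) := by
    ext s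
    by_cases hs : s ∈ T <;> simp [kill, hs]
  rw [this]
  simp only [AlgHom.comp_apply] at hx ⊢
  rw [hx, map_zero]

/-- The chain of killed sets. -/
def chain (k : ℕ) : Set (Fin m ⊕ Fin n) :=
  {s | Sum.elim (fun i : Fin m => 1 ≤ i.1 ∧ i.1 ≤ k) (fun j : Fin n => 1 ≤ j.1 ∧ j.1 + (m - 1) ≤ k) s}

theorem height_chain (hm : 1 ≤ m) (hn : 1 ≤ n) (k : ℕ) (hk : k ≤ (m - 1) + (n - 1)) :
    (k : ℕ∞) ≤ (pr m n (chain m n k)).height := by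
  induction k with
  | zero => simp
  | succ k ih =>
    have hsub : chain m n k ⊆ chain m n (k + 1) := by
      rintro (i | j) h
      · simp only [chain, Set.mem_ofPred_eq, Sum.elim_inl] at h ⊢; omega
      · simp only [chain, Set.mem_ofPred_eq, Sum.elim_inr] at h ⊢; omega
    have hlt : pr m n (chain m n k) < pr m n (chain m n (k + 1)) := by
      by_cases hkm : k < m - 1
      · apply pr_lt m n hsub (⟨k + 1, by omega⟩, ⟨0, by omega⟩) <;>
          simp [gen_mem_pr, chain]
      · apply pr_lt m n hsub (⟨0, by omega⟩, ⟨k + 1 - (m - 1), by omega⟩) <;>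
          simp [gen_mem_pr, chain] <;> omega
    have := Ideal.height_add_one_le_of_lt_of_isPrime hlt
    push_cast
    exact (add_le_add_left (ih (by omega)) 1).trans this

theorem height_irr (hm : 1 ≤ m) (hn : 1 ≤ n) :
    (((m - 1) + (n - 1) + 1 : ℕ) : ℕ∞) ≤ (irr m n).height := by
  have hlt : pr m n (chain m n ((m - 1) + (n - 1))) < irr m n := by
    apply pr_lt_irr m n (⟨0, by omega⟩, ⟨0, by omega⟩)
    simp [gen_mem_pr, chain]
  have := Ideal.height_add_one_le_of_lt_of_isPrime hlt
  rw [Nat.cast_add, Nat.cast_one]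
  exact (add_le_add_left (height_chain m n hm hn _ le_rfl) 1).trans this

instance : Algebra.FiniteType ℂ (R m n) :=
  Algebra.FiniteType.of_surjective (seg m n).rangeRestrict (seg m n).rangeRestrict_surjective

instance : IsNoetherianRing (R m n) := Algebra.FiniteType.isNoetherianRing ℂ _
instance : IsJacobsonRing (R m n) := isJacobsonRing_of_finiteType (A := ℂ)

theorem exists_hom {A : Type*} [CommRing A] [Algebra ℂ A] [Algebra.FiniteType ℂ A]
    (M : Ideal A) [M.IsMaximal] : ∃ ψ : A →ₐ[ℂ] ℂ, RingHom.ker ψ = M := by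
  let _ : Field (A ⧸ M) := Ideal.Quotient.field M
  have : Algebra.FiniteType ℂ (A ⧸ M) :=
    Algebra.FiniteType.of_surjective (Ideal.Quotient.mkₐ ℂ M) Ideal.Quotient.mk_surjective
  have : Module.Finite ℂ (A ⧸ M) := finite_of_finite_type_of_isJacobsonRing _ _
  have hb : Function.Bijective (algebraMap ℂ (A ⧸ M)) :=
    IsAlgClosed.algebraMap_bijective_of_isIntegral
  let e : ℂ ≃ₐ[ℂ] (A ⧸ M) := AlgEquiv.ofBijective (Algebra.ofId _ _) hb
  refine ⟨e.symm.toAlgHom.comp (Ideal.Quotient.mkₐ ℂ M), ?_⟩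
  ext x
  rw [RingHom.mem_ker]
  change e.symm (Ideal.Quotient.mk M x) = 0 ↔ _
  rw [EmbeddingLike.map_eq_zero_iff, Ideal.Quotient.eq_zero_iff_mem]

theorem irr_le (ψ : R m n →ₐ[ℂ] ℂ) (h : ∀ p, ψ (gen m n p) = 0) : irr m n ≤ RingHom.ker ψ := by
  have key : ψ.comp (seg m n).rangeRestrict =
      ((MvPolynomial.aeval (fun _ => (0 : ℂ)) :
        MvPolynomial (Fin m ⊕ Fin n) ℂ →ₐ[ℂ] ℂ).comp (R m n).val).comp
          (seg m n).rangeRestrict := by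
    apply MvPolynomial.algHom_ext
    intro p
    refine (h p).trans ?_
    change _ = MvPolynomial.aeval (fun _ => (0 : ℂ))
      ((gen m n p : R m n) : MvPolynomial (Fin m ⊕ Fin n) ℂ)
    simp [gen_val]
  intro x hx
  obtain ⟨f, rfl⟩ := (seg m n).rangeRestrict_surjective x
  rw [irr, RingHom.mem_ker] at hx
  rw [RingHom.mem_ker]
  exact (DFunLike.congr_fun key f).trans hx

theorem gen_mul (i k : Fin m) (j l : Fin n) :
    gen m n (i, j) * gen m n (k, l) = gen m n (i, l) * gen m n (k, j) := by
  apply Subtype.ext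
  simp only [MulMemClass.coe_mul, gen_val]
  ring

end SegreAux

open SegreAux in
theorem stmt_12 (m n : ℕ) (S : Submodule ℂ (Fin m × Fin n → ℂ))
    (h : (m - 1) * (n - 1) < Module.finrank ℂ S) :
    ∃ (a : Fin m → ℂ) (b : Fin n → ℂ),
      (fun p : Fin m × Fin n => a p.1 * b p.2) ∈ S ∧
      (fun p : Fin m × Fin n => a p.1 * b p.2) ≠ 0 := by
  by_contra! hcon
  have hle : Module.finrank ℂ S ≤ m * n := by
    have := Submodule.finrank_le S
    simpa using this
  have hm : 1 ≤ m := by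
    rcases Nat.eq_zero_or_pos m with rfl | h0
    · rw [Nat.zero_mul] at hle; omega
    · exact h0
  have hn : 1 ≤ n := by
    rcases Nat.eq_zero_or_pos n with rfl | h0
    · rw [Nat.mul_zero] at hle; omega
    · exact h0
  have hq : Module.finrank ℂ ((Fin m × Fin n → ℂ) ⧸ S) ≤ (m - 1) + (n - 1) := by
    have := Submodule.finrank_quotient_add_finrank S
    simp at this
    obtain ⟨m, rfl⟩ := Nat.exists_eq_add_of_le' hm
    obtain ⟨n, rfl⟩ := Nat.exists_eq_add_of_le' hn
    simp at h ⊢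
    nlinarith
  set r := Module.finrank ℂ ((Fin m × Fin n → ℂ) ⧸ S) with hr
  let L : (Fin m × Fin n → ℂ) →ₗ[ℂ] (Fin r → ℂ) :=
    (Module.finBasis ℂ ((Fin m × Fin n → ℂ) ⧸ S)).equivFun.toLinearMap ∘ₗ S.mkQ
  have hL : ∀ x, L x = 0 → x ∈ S := by
    intro x hx
    simpa [L] using hx
  let f : Fin r → R m n := fun k => ∑ p, L (Pi.single p 1) k • gen m n p
  have hf : ∀ (ψ : R m n →ₐ[ℂ] ℂ) k, ψ (f k) = L (fun p => ψ (gen m n p)) k := by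
    intro ψ k
    have : (fun p => ψ (gen m n p)) = ∑ p, ψ (gen m n p) • (Pi.single p 1 : Fin m × Fin n → ℂ) := by
      ext q
      simp [Finset.sum_apply, Pi.single_apply]
    rw [this]
    simp only [f, map_sum, map_smul, Finset.sum_apply, Pi.smul_apply, smul_eq_mul]
    exact Finset.sum_congr rfl fun _ _ => mul_comm _ _
  have hmin : irr m n ∈ (Ideal.span (Set.range f)).minimalPrimes := by
    refine ⟨⟨inferInstance, ?_⟩, ?_⟩
    · rw [Ideal.span_le]
      rintro _ ⟨k, rfl⟩
      refine Ideal.sum_mem _ fun p _ => ?_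
      refine Submodule.smul_of_tower_mem _ _ ?_
      rw [irr, RingHom.mem_ker]
      simp [gen_val]
    · rintro p ⟨hp, hIp⟩ -
      rw [← IsJacobsonRing.out inferInstance hp.isRadical]
      refine le_sInf ?_
      rintro M ⟨hpM, hM⟩
      obtain ⟨ψ, rfl⟩ := exists_hom M
      apply irr_le
      by_contra! hne
      obtain ⟨⟨i, j⟩, hij⟩ := hne
      have hS : (fun p => ψ (gen m n p)) ∈ S := by
        apply hL
        ext k
        rw [← hf]
        exact hpM (hIp (Ideal.subset_span ⟨k, rfl⟩))
      have heq : (fun p : Fin m × Fin n => ψ (gen m n (p.1, j)) *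
          (ψ (gen m n (i, p.2)) / ψ (gen m n (i, j)))) = fun p => ψ (gen m n p) := by
        ext ⟨k, l⟩
        have := congrArg ψ (gen_mul m n k i j l)
        simp only [map_mul] at this
        field_simp
        exact this.trans (mul_comm _ _)
      have := hcon (fun k => ψ (gen m n (k, j))) 
        (fun l => ψ (gen m n (i, l)) / ψ (gen m n (i, j))) (by rw [heq]; exact hS)
      rw [heq] at this
      exact hij (congrFun this (i, j))
  have h1 := Ideal.height_le_card_of_mem_minimalPrimes_span (Set.finite_range f) hmin
  have h2 := (height_irr m n hm hn).trans h1
  have h3 : (Set.range f).ncard ≤ r := by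
    rw [← Set.image_univ]
    refine (Set.ncard_image_le Set.finite_univ).trans ?_
    simp [Set.ncard_univ]
  have h4 : (m - 1) + (n - 1) + 1 ≤ (Set.range f).ncard := by exact_mod_cast h2
  omega
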